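/- Let a > 0 and let s be a real number with -2a < s < 1/2. Then ∫₀^∞ ∫₀^∞ (x+y)^s f_{a,1/2}(x) f_{a,1/2}(y) dx dy = [Γ(2a+s)Γ(1/2−s)/(Γ(2a)Γ(1/2))] · [Γ(a+1/2)/(Γ(a)Γ(1/2))] · ∫₀^1 u^{a−1}(1−u)^{−1/2}(1+√u)^s du. (This is the Mellin-transform form of the identity in law B'_{a,1/2} + B'_{a,1/2} = B'_{2a,1/2} × (1 + √B_{a,1/2}) of Theorem A.) -/

import Mathlib

open MeasureTheory Set

/-- The beta prime density with parameters `a, b`. -/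
noncomputable def betaPrimeDensity (a b x : ℝ) : ℝ :=
  Real.Gamma (a + b) / (Real.Gamma a * Real.Gamma b) * x ^ (a - 1) * (1 + x) ^ (-(a + b))

open ProbabilityTheory (beta beta_pos)

/-- Gamma integral as a lower Lebesgue integral. -/
lemma lintegral_rpow_mul_exp_neg_mul_Ioi {a r : ℝ} (ha : 0 < a) (hr : 0 < r) :
    ∫⁻ t in Ioi (0 : ℝ), ENNReal.ofReal (t ^ (a - 1) * Real.exp (-(r * t)))
      = ENNReal.ofReal (r ^ (-a) * Real.Gamma a) := by
  have h := Real.integral_rpow_mul_exp_neg_mul_Ioi ha hr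
  have hG := Real.Gamma_pos_of_pos ha
  rw [one_div, Real.inv_rpow hr.le, ← Real.rpow_neg hr.le] at h
  rw [← h, ofReal_integral_eq_lintegral_ofReal]
  · refine Integrable.of_integral_ne_zero ?_
    rw [h]
    positivity
  · filter_upwards [ae_restrict_mem measurableSet_Ioi] with t ht
    have ht : 0 < t := ht
    positivity

/-- Beta integral over the half-line with an affine weight. -/
lemma lintegral_rpow_mul_add_mul_rpow_Ioi {α β p q : ℝ} (hα : 0 < α) (hβ : 0 < β)
    (hp : 0 < p) (hq : 0 < q) :
    ∫⁻ z in Ioi (0 : ℝ), ENNReal.ofReal (z ^ (α - 1) * (p + q * z) ^ (-(α + β)))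
      = ENNReal.ofReal (beta α β * p ^ (-β) * q ^ (-α)) := by
  have hG : 0 < Real.Gamma (α + β) := Real.Gamma_pos_of_pos (by positivity)
  have hGα := Real.Gamma_pos_of_pos hα
  have hGβ := Real.Gamma_pos_of_pos hβ
  have key : ENNReal.ofReal (Real.Gamma (α + β)) *
      ∫⁻ z in Ioi (0 : ℝ), ENNReal.ofReal (z ^ (α - 1) * (p + q * z) ^ (-(α + β)))
      = ENNReal.ofReal (Real.Gamma (α + β)) *
        ENNReal.ofReal (beta α β * p ^ (-β) * q ^ (-α)) := by
    calc
      _ = ∫⁻ z in Ioi (0 : ℝ), ∫⁻ t in Ioi (0 : ℝ), ENNReal.ofReal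
            (z ^ (α - 1) * (t ^ (α + β - 1) * Real.exp (-((p + q * z) * t)))) := by
          rw [← lintegral_const_mul' _ _ ENNReal.ofReal_ne_top]
          refine setLIntegral_congr_fun measurableSet_Ioi fun z hz => ?_
          have hz : 0 < z := hz
          have hz' : 0 ≤ z ^ (α - 1) := by positivity
          simp only [ENNReal.ofReal_mul hz']
          rw [lintegral_const_mul' _ _ ENNReal.ofReal_ne_top,
            lintegral_rpow_mul_exp_neg_mul_Ioi (by positivity) (by positivity),
            ENNReal.ofReal_mul (by positivity)]
          ring
      _ = ∫⁻ t in Ioi (0 : ℝ), ∫⁻ z in Ioi (0 : ℝ), ENNReal.ofReal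
            (z ^ (α - 1) * (t ^ (α + β - 1) * Real.exp (-((p + q * z) * t)))) := by
          refine lintegral_lintegral_swap ?_
          unfold Function.uncurry
          fun_prop
      _ = ∫⁻ t in Ioi (0 : ℝ), ENNReal.ofReal (q ^ (-α) * Real.Gamma α) *
            ENNReal.ofReal (t ^ (β - 1) * Real.exp (-(p * t))) := by
          refine setLIntegral_congr_fun measurableSet_Ioi fun t ht => ?_
          have ht : 0 < t := ht
          have h0 : 0 ≤ t ^ (α + β - 1) * Real.exp (-(p * t)) := by positivity
          have : ∀ z : ℝ, z ^ (α - 1) * (t ^ (α + β - 1) * Real.exp (-((p + q * z) * t)))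
              = t ^ (α + β - 1) * Real.exp (-(p * t)) *
                (z ^ (α - 1) * Real.exp (-((q * t) * z))) := fun z => by
            rw [show -((p + q * z) * t) = -(p * t) + -((q * t) * z) by ring, Real.exp_add]
            ring
          simp only [this, ENNReal.ofReal_mul h0]
          rw [lintegral_const_mul' _ _ ENNReal.ofReal_ne_top,
            lintegral_rpow_mul_exp_neg_mul_Ioi hα (by positivity),
            ← ENNReal.ofReal_mul (by positivity), ← ENNReal.ofReal_mul (by positivity),
            Real.mul_rpow hq.le ht.le,
            show β - 1 = (α + β - 1) + (-α) by ring, Real.rpow_add ht]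
          congr 1
          ring
      _ = _ := by
          rw [lintegral_const_mul' _ _ ENNReal.ofReal_ne_top,
            lintegral_rpow_mul_exp_neg_mul_Ioi hβ hp, ← ENNReal.ofReal_mul (by positivity),
            ← ENNReal.ofReal_mul (by positivity), beta]
          congr 1
          field_simp
  exact (ENNReal.mul_right_inj (ENNReal.ofReal_pos.2 hG).ne' ENNReal.ofReal_ne_top).1 key

/-- Euler's integral for `₂F₁` in the case where it degenerates to an elementary function. -/
lemma lintegral_rpow_mul_one_sub_rpow_mul_add_mul_rpow {α β p q : ℝ} (hα : 0 < α) (hβ : 0 < β)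
    (hp : 0 < p) (hq : 0 ≤ q) :
    ∫⁻ w in Ioo (0 : ℝ) 1,
        ENNReal.ofReal (w ^ (α - 1) * (1 - w) ^ (β - 1) * (p + q * w) ^ (-(α + β)))
      = ENNReal.ofReal (beta α β * p ^ (-β) * (p + q) ^ (-α)) := by
  rw [← lintegral_rpow_mul_add_mul_rpow_Ioi hα hβ hp (by positivity : 0 < p + q)]
  have himg : (fun w : ℝ => w / (1 - w)) '' Ioo 0 1 = Ioi 0 := by
    ext z
    constructor
    · rintro ⟨w, ⟨h0, h1⟩, rfl⟩
      exact div_pos h0 (sub_pos.2 h1)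
    · intro hz
      have hz : 0 < z := hz
      refine ⟨z / (1 + z), ⟨by positivity, (div_lt_one (by positivity)).2 (by linarith)⟩, ?_⟩
      simp only
      field_simp
      ring
  rw [← himg, lintegral_image_eq_lintegral_abs_deriv_mul (f' := fun w => 1 / (1 - w) ^ 2)
    measurableSet_Ioo]
  · refine setLIntegral_congr_fun measurableSet_Ioo fun w ⟨h0, h1⟩ => ?_
    have h1 : 0 < 1 - w := sub_pos.2 h1
    have h2 : 0 < p + q * w := by positivity
    rw [← ENNReal.ofReal_mul (abs_nonneg _), abs_of_pos (by positivity),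
      show p + (p + q) * (w / (1 - w)) = (p + q * w) / (1 - w) by field_simp; ring,
      Real.div_rpow h0.le h1.le, Real.div_rpow h2.le h1.le, ← Real.rpow_natCast]
    congr 1
    have : (1 - w) ^ (β - 1) * ((1 - w) ^ ((2 : ℕ) : ℝ) * (1 - w) ^ (α - 1) *
        (1 - w) ^ (-(α + β))) = 1 := by
      rw [← Real.rpow_add h1, ← Real.rpow_add h1, ← Real.rpow_add h1]
      convert Real.rpow_zero _ using 2
      push_cast; ring
    field_simp
    linear_combination this
  · intro w ⟨h0, h1⟩
    have h1 : 1 - w ≠ 0 := (sub_pos.2 h1).ne'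
    refine HasDerivAt.hasDerivWithinAt ?_
    exact ((hasDerivAt_id w).div ((hasDerivAt_id w).const_sub 1) h1).congr_deriv (by simp)
  · intro w ⟨h0, h1⟩ v ⟨h0', h1'⟩ h
    have h1 : 1 - w ≠ 0 := (sub_pos.2 h1).ne'
    have h1' : 1 - v ≠ 0 := (sub_pos.2 h1').ne'
    simp only at h
    field_simp at h
    linarith

/-- Tonelli's theorem in the coordinates `(x, x + y)` on the positive quadrant. -/
lemma lintegral_lintegral_Ioi_eq_lintegral_lintegral_Ioo {F : ℝ → ℝ → ENNReal}
    (hF : Measurable (Function.uncurry F)) :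
    ∫⁻ x in Ioi (0 : ℝ), ∫⁻ y in Ioi (0 : ℝ), F x y
      = ∫⁻ r in Ioi (0 : ℝ), ∫⁻ x in Ioo 0 r, F x (r - x) := by
  have hm : Measurable (Function.uncurry fun x r : ℝ => F x (r - x)) :=
    hF.comp (measurable_fst.prodMk (measurable_snd.sub measurable_fst))
  calc
    _ = ∫⁻ x, ∫⁻ r, {z : ℝ × ℝ | 0 < z.1 ∧ z.1 < z.2}.indicator
          (Function.uncurry fun x r : ℝ => F x (r - x)) (x, r) := by
        rw [← lintegral_indicator measurableSet_Ioi]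
        refine lintegral_congr fun x => ?_
        by_cases hx : 0 < x
        · rw [indicator_of_mem (by exact hx), ← lintegral_indicator measurableSet_Ioi,
            ← lintegral_sub_right_eq_self _ x]
          refine lintegral_congr fun r => ?_
          simp [indicator, hx]
        · simp [indicator, hx]
    _ = ∫⁻ r, ∫⁻ x, {z : ℝ × ℝ | 0 < z.1 ∧ z.1 < z.2}.indicator
          (Function.uncurry fun x r : ℝ => F x (r - x)) (x, r) := by
        refine lintegral_lintegral_swap (Measurable.aemeasurable ?_)
        exact hm.indicator ((measurableSet_lt measurable_const measurable_fst).inter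
          (measurableSet_lt measurable_fst measurable_snd))
    _ = _ := by
        rw [← lintegral_indicator measurableSet_Ioi]
        refine lintegral_congr fun r => ?_
        by_cases hr : 0 < r
        · rw [indicator_of_mem (by exact hr), ← lintegral_indicator measurableSet_Ioo]
          refine lintegral_congr fun x => ?_
          simp [indicator]
        · rw [indicator_of_notMem (by exact hr)]
          refine (lintegral_congr fun x => ?_).trans lintegral_zero
          refine indicator_of_notMem ?_ _
          rintro ⟨h1, h2⟩
          exact hr (h1.trans h2)

/-- A function symmetric about the midpoint of an interval has the same integral on each half. -/
lemma setLIntegral_Ioo_eq_two_mul_of_symm {r : ℝ} (hr : 0 < r) {g : ℝ → ENNReal}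
    (hg : ∀ x, g (r - x) = g x) :
    ∫⁻ x in Ioo 0 r, g x = 2 * ∫⁻ x in Ioo 0 (r / 2), g x := by
  have h2 : ∫⁻ x in Ioo (r / 2) r, g x = ∫⁻ x in Ioo 0 (r / 2), g x := by
    rw [← lintegral_indicator measurableSet_Ioo, ← lintegral_indicator measurableSet_Ioo,
      ← lintegral_sub_left_eq_self _ r]
    refine lintegral_congr fun x => ?_
    have : r - x ∈ Ioo (r / 2) r ↔ x ∈ Ioo 0 (r / 2) := by
      simp only [mem_Ioo]
      constructor <;> rintro ⟨h, h'⟩ <;> constructor <;> linarith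
    by_cases hx : x ∈ Ioo 0 (r / 2)
    · rw [indicator_of_mem hx, indicator_of_mem (this.2 hx), hg]
    · rw [indicator_of_notMem hx, indicator_of_notMem (this.not.2 hx)]
  rw [← Ioc_union_Ioo_eq_Ioo (by positivity : 0 ≤ r / 2) (by linarith : r / 2 < r),
    lintegral_union measurableSet_Ioo, setLIntegral_congr Ioo_ae_eq_Ioc.symm, h2, two_mul]
  exact Set.disjoint_left.2 fun x hx hx' => hx.2.not_gt hx'.1

/-- The convolution square of the unnormalised beta prime density with second parameter `1 / 2`. -/
lemma lintegral_Ioo_mul_sub_rpow_mul_rpow {a r : ℝ} (ha : 0 < a) (hr : 0 < r) :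
    ∫⁻ x in Ioo 0 r, ENNReal.ofReal
        ((x * (r - x)) ^ (a - 1) * ((1 + x) * (1 + (r - x))) ^ (-(a + 1 / 2)))
      = ENNReal.ofReal (2 * beta a (1 / 2)) * ENNReal.ofReal
          (r ^ (2 * a - 1) * (1 + r) ^ (-(1 / 2) : ℝ) * (2 + r) ^ (-(2 * a))) := by
  have hB := beta_pos ha (by norm_num : (0 : ℝ) < 1 / 2)
  rw [setLIntegral_Ioo_eq_two_mul_of_symm hr fun x => by rw [sub_sub_cancel]; ring_nf]
  have himg : (fun x : ℝ => 4 * (x * (r - x)) / r ^ 2) '' Ioo 0 (r / 2) = Ioo 0 1 := by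
    ext v
    constructor
    · rintro ⟨x, ⟨h0, h1⟩, rfl⟩
      have h2 : 0 < r - x := by linarith
      refine ⟨by positivity, (div_lt_one (by positivity)).2 ?_⟩
      nlinarith [mul_pos (by linarith : 0 < r - 2 * x) (by linarith : 0 < r - 2 * x)]
    · rintro ⟨h0, h1⟩
      have h2 : 0 < √(1 - v) := Real.sqrt_pos.2 (by linarith)
      have h3 : √(1 - v) < 1 := by
        rw [Real.sqrt_lt' one_pos]
        linarith
      have h4 : √(1 - v) ^ 2 = 1 - v := Real.sq_sqrt (by linarith)
      refine ⟨r / 2 * (1 - √(1 - v)), ⟨mul_pos (by positivity) (by linarith), ?_⟩, ?_⟩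
      · nlinarith
      · field_simp
        linear_combination -4 * h4
  have h := lintegral_rpow_mul_one_sub_rpow_mul_add_mul_rpow ha (by norm_num : (0 : ℝ) < 1 / 2)
    (by positivity : 0 < 1 + r) (by positivity : 0 ≤ r ^ 2 / 4)
  rw [← himg, lintegral_image_eq_lintegral_abs_deriv_mul
    (f' := fun x => 4 * (r - 2 * x) / r ^ 2) measurableSet_Ioo] at h
  · have hint : ∫⁻ x in Ioo 0 (r / 2), ENNReal.ofReal
        ((x * (r - x)) ^ (a - 1) * ((1 + x) * (1 + (r - x))) ^ (-(a + 1 / 2)))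
        = ENNReal.ofReal (4 ^ (-a) * r ^ (2 * a - 1)) *
          ENNReal.ofReal (beta a (1 / 2) * (1 + r) ^ (-(1 / 2) : ℝ) *
            (1 + r + r ^ 2 / 4) ^ (-a)) := by
      rw [← h, ← lintegral_const_mul' _ _ ENNReal.ofReal_ne_top]
      refine setLIntegral_congr_fun measurableSet_Ioo fun x ⟨h0, h1⟩ => ?_
      have h2 : 0 < r - x := by linarith
      have h3 : 0 < r - 2 * x := by linarith
      rw [← ENNReal.ofReal_mul (abs_nonneg _), ← ENNReal.ofReal_mul (by positivity),
        abs_of_pos (by positivity),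
        show 1 + r + r ^ 2 / 4 * (4 * (x * (r - x)) / r ^ 2) = (1 + x) * (1 + (r - x)) by
          field_simp; ring,
        show 1 - 4 * (x * (r - x)) / r ^ 2 = ((r - 2 * x) / r) ^ 2 by field_simp; ring,
        ← Real.rpow_natCast ((r - 2 * x) / r), ← Real.rpow_mul (by positivity),
        show ((2 : ℕ) : ℝ) * (1 / 2 - 1) = -1 by norm_num, Real.rpow_neg_one,
        Real.div_rpow (by positivity) (by positivity),
        Real.mul_rpow (by norm_num : (0 : ℝ) ≤ 4) (by positivity), ← Real.rpow_natCast r 2,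
        ← Real.rpow_mul hr.le, Real.rpow_neg (by norm_num : (0 : ℝ) ≤ 4),
        Real.rpow_sub_one (four_ne_zero : (4 : ℝ) ≠ 0),
        show 2 * a - 1 = ((2 : ℕ) : ℝ) * (a - 1) + 1 by push_cast; ring, Real.rpow_add hr,
        Real.rpow_one, Real.rpow_natCast]
      congr 1
      field_simp
      exact (div_self (by linarith : 0 < r - x * 2).ne').symm
    rw [hint, ← ENNReal.ofReal_mul (by positivity), ← ENNReal.ofReal_mul (by positivity),
      ← ENNReal.ofReal_ofNat 2, ← ENNReal.ofReal_mul (by norm_num),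
      show 1 + r + r ^ 2 / 4 = (2 + r) ^ 2 / 4 by ring,
      Real.div_rpow (by positivity) (by norm_num), ← Real.rpow_natCast (2 + r),
      ← Real.rpow_mul (by positivity)]
    congr 1
    push_cast
    rw [mul_neg]
    field_simp
  · intro x _
    refine HasDerivAt.hasDerivWithinAt ?_
    refine ((((hasDerivAt_id x).mul ((hasDerivAt_id x).const_sub r)).const_mul 4).div_const
      (r ^ 2)).congr_deriv ?_
    simp only [id]
    ring
  · intro x ⟨h0, h1⟩ y ⟨h0', h1'⟩ h
    simp only at h
    field_simp at h
    have : (x - y) * (r - x - y) = 0 := by linear_combination h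
    rcases mul_eq_zero.1 this with h | h <;> linarith

/-- The substitution `u = w ^ 2` in the Mellin transform of `1 + √B` with `B` beta distributed. -/
lemma lintegral_Ioo_rpow_mul_one_add_sqrt_rpow (a s : ℝ) :
    ∫⁻ u in Ioo (0 : ℝ) 1, ENNReal.ofReal
        (u ^ (a - 1) * (1 - u) ^ (-(1 / 2) : ℝ) * (1 + √u) ^ s)
      = 2 * ∫⁻ w in Ioo (0 : ℝ) 1, ENNReal.ofReal
        (w ^ (2 * a - 1) * (1 - w) ^ (-(1 / 2) : ℝ) * (1 + w) ^ (s - 1 / 2)) := by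
  have himg : (fun w : ℝ => w ^ 2) '' Ioo 0 1 = Ioo 0 1 := by
    ext u
    constructor
    · rintro ⟨w, ⟨h0, h1⟩, rfl⟩
      exact ⟨by positivity, by simp only; nlinarith⟩
    · rintro ⟨h0, h1⟩
      refine ⟨√u, ⟨Real.sqrt_pos.2 h0, ?_⟩, Real.sq_sqrt h0.le⟩
      rwa [Real.sqrt_lt' one_pos, one_pow]
  rw [← lintegral_const_mul' _ _ ENNReal.ofNat_ne_top]
  nth_rw 1 [← himg]
  rw [lintegral_image_eq_lintegral_abs_deriv_mul (f' := fun w => 2 * w) measurableSet_Ioo]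
  · refine setLIntegral_congr_fun measurableSet_Ioo fun w ⟨h0, h1⟩ => ?_
    have h1 : 0 < 1 - w := sub_pos.2 h1
    have h2 : 0 < 1 + w := by positivity
    rw [← ENNReal.ofReal_mul (abs_nonneg _), abs_of_pos (by positivity), Real.sqrt_sq h0.le,
      ← ENNReal.ofReal_ofNat 2, ← ENNReal.ofReal_mul (by norm_num),
      show 1 - w ^ 2 = (1 - w) * (1 + w) by ring, Real.mul_rpow h1.le h2.le,
      ← Real.rpow_natCast w, ← Real.rpow_mul h0.le, sub_eq_add_neg s, Real.rpow_add h2,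
      show 2 * a - 1 = ((2 : ℕ) : ℝ) * (a - 1) + 1 by push_cast; ring, Real.rpow_add h0,
      Real.rpow_one]
    congr 1
    ring
  · intro w _
    exact (((hasDerivAt_id w).pow 2).congr_deriv (by simp)).hasDerivWithinAt
  · intro w ⟨h0, _⟩ v ⟨h0', _⟩ h
    exact (pow_left_inj₀ h0.le h0'.le two_ne_zero).1 h

/-- Two iterated evaluations of the double integral of
`w ^ (2a-1) (1-w) ^ (-1/2) r ^ (2a+s-1) (1+w+r) ^ (-2a-1/2)`. -/
lemma beta_mul_lintegral_eq_beta_mul_lintegral {a s : ℝ} (ha : 0 < a) (hs1 : -2 * a < s)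
    (hs2 : s < 1 / 2) :
    ENNReal.ofReal (beta (2 * a + s) (1 / 2 - s)) * ∫⁻ w in Ioo (0 : ℝ) 1, ENNReal.ofReal
        (w ^ (2 * a - 1) * (1 - w) ^ (-(1 / 2) : ℝ) * (1 + w) ^ (s - 1 / 2))
      = ENNReal.ofReal (beta (2 * a) (1 / 2)) * ∫⁻ r in Ioi (0 : ℝ), ENNReal.ofReal
        (r ^ s * (r ^ (2 * a - 1) * (1 + r) ^ (-(1 / 2) : ℝ) * (2 + r) ^ (-(2 * a)))) := by
  have hα : 0 < 2 * a + s := by linarith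
  have hβ : 0 < 1 / 2 - s := by linarith
  have hB := beta_pos hα hβ
  have hB' := beta_pos (by positivity : 0 < 2 * a) (by norm_num : (0 : ℝ) < 1 / 2)
  calc
    _ = ∫⁻ w in Ioo (0 : ℝ) 1, ∫⁻ r in Ioi (0 : ℝ), ENNReal.ofReal
          (w ^ (2 * a - 1) * (1 - w) ^ (-(1 / 2) : ℝ) *
            (r ^ (2 * a + s - 1) * (1 + w + 1 * r) ^ (-(2 * a + s + (1 / 2 - s))))) := by
        rw [← lintegral_const_mul' _ _ ENNReal.ofReal_ne_top]
        refine setLIntegral_congr_fun measurableSet_Ioo fun w ⟨h0, h1⟩ => ?_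
        have h1 : 0 < 1 - w := sub_pos.2 h1
        have h2 : 0 ≤ w ^ (2 * a - 1) * (1 - w) ^ (-(1 / 2) : ℝ) := by positivity
        simp only [ENNReal.ofReal_mul h2]
        rw [lintegral_const_mul' _ _ ENNReal.ofReal_ne_top,
          lintegral_rpow_mul_add_mul_rpow_Ioi hα hβ (by positivity) one_pos, Real.one_rpow,
          mul_one, neg_sub, ENNReal.ofReal_mul hB.le]
        ring
    _ = ∫⁻ r in Ioi (0 : ℝ), ∫⁻ w in Ioo (0 : ℝ) 1, ENNReal.ofReal
          (w ^ (2 * a - 1) * (1 - w) ^ (-(1 / 2) : ℝ) *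
            (r ^ (2 * a + s - 1) * (1 + w + 1 * r) ^ (-(2 * a + s + (1 / 2 - s))))) := by
        refine lintegral_lintegral_swap ?_
        unfold Function.uncurry
        fun_prop
    _ = _ := by
        rw [← lintegral_const_mul' _ _ ENNReal.ofReal_ne_top]
        refine setLIntegral_congr_fun measurableSet_Ioi fun r hr => ?_
        have hr : 0 < r := hr
        have h2 : 0 ≤ r ^ (2 * a + s - 1) := by positivity
        have h3 : ∀ w : ℝ, w ^ (2 * a - 1) * (1 - w) ^ (-(1 / 2) : ℝ) *
            (r ^ (2 * a + s - 1) * (1 + w + 1 * r) ^ (-(2 * a + s + (1 / 2 - s))))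
            = r ^ (2 * a + s - 1) * (w ^ (2 * a - 1) * (1 - w) ^ ((1 / 2 : ℝ) - 1) *
              (1 + r + 1 * w) ^ (-(2 * a + 1 / 2))) := fun w => by
          rw [show 1 + w + 1 * r = 1 + r + 1 * w by ring,
            show 2 * a + s + (1 / 2 - s) = 2 * a + 1 / 2 by ring,
            show (1 / 2 : ℝ) - 1 = -(1 / 2) by norm_num]
          ring
        simp only [h3, ENNReal.ofReal_mul h2]
        rw [lintegral_const_mul' _ _ ENNReal.ofReal_ne_top,
          lintegral_rpow_mul_one_sub_rpow_mul_add_mul_rpow (by positivity) (by norm_num)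
            (by positivity) zero_le_one,
          ← ENNReal.ofReal_mul (by positivity), ← ENNReal.ofReal_mul (by positivity),
          show 2 * a + s - 1 = s + (2 * a - 1) by ring, Real.rpow_add hr,
          show 1 + r + 1 = 2 + r by ring]
        congr 1
        ring

/-- The moments of `1 + √B` with `B` beta distributed are finite. -/
lemma lintegral_Ioo_rpow_mul_one_add_sqrt_rpow_ne_top {a : ℝ} (ha : 0 < a) (s : ℝ) :
    ∫⁻ u in Ioo (0 : ℝ) 1, ENNReal.ofReal
        (u ^ (a - 1) * (1 - u) ^ (-(1 / 2) : ℝ) * (1 + √u) ^ s) ≠ ⊤ := by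
  have h := lintegral_rpow_mul_one_sub_rpow_mul_add_mul_rpow ha (by norm_num : (0 : ℝ) < 1 / 2)
    one_pos le_rfl
  refine ne_top_of_le_ne_top (ENNReal.mul_ne_top (ENNReal.ofReal_ne_top (r := 2 ^ |s|))
    (h ▸ ENNReal.ofReal_ne_top)) ?_
  rw [← lintegral_const_mul' _ _ ENNReal.ofReal_ne_top]
  refine setLIntegral_mono' measurableSet_Ioo fun u ⟨h0, h1⟩ => ?_
  have h1' : 0 < 1 - u := sub_pos.2 h1
  have h2 : √u ≤ 1 := Real.sqrt_le_one.2 h1.le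
  rw [← ENNReal.ofReal_mul (by positivity), zero_mul, add_zero, Real.one_rpow, mul_one, mul_comm,
    show (1 / 2 : ℝ) - 1 = -(1 / 2) by norm_num]
  gcongr
  calc (1 + √u) ^ s ≤ (1 + √u) ^ |s| :=
        Real.rpow_le_rpow_of_exponent_le (by linarith [Real.sqrt_nonneg u]) (le_abs_self s)
    _ ≤ 2 ^ |s| := by gcongr; linarith

/-- An iterated integral of a nonnegative function is given by its lower Lebesgue integral. -/
lemma setIntegral_setIntegral_eq_toReal {G : ℝ → ℝ → ℝ} {S T : Set ℝ} (hS : MeasurableSet S)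
    (hT : MeasurableSet T) (hG : Measurable (Function.uncurry G))
    (h0 : ∀ x ∈ S, ∀ y ∈ T, 0 ≤ G x y)
    (hfin : ∫⁻ x in S, ∫⁻ y in T, ENNReal.ofReal (G x y) ≠ ⊤) :
    ∫ x in S, ∫ y in T, G x y = (∫⁻ x in S, ∫⁻ y in T, ENNReal.ofReal (G x y)).toReal := by
  have hm : Measurable fun x => ∫⁻ y in T, ENNReal.ofReal (G x y) :=
    Measurable.lintegral_prod_right' (f := fun z : ℝ × ℝ => ENNReal.ofReal (G z.1 z.2))
      hG.ennreal_ofReal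
  rw [← integral_toReal hm.aemeasurable (ae_lt_top hm hfin)]
  refine setIntegral_congr_fun hS fun x hx => ?_
  refine integral_eq_lintegral_of_nonneg_ae ?_ ?_
  · filter_upwards [ae_restrict_mem hT] with y hy using h0 x hx y hy
  · exact (hG.comp measurable_prodMk_left).aestronglyMeasurable

/-- Mellin-transform form of Theorem A:
`B'_{a,1/2} + B'_{a,1/2} = B'_{2a,1/2} × (1 + √B_{a,1/2})` in law. -/
theorem theoremA_mellin (a s : ℝ) (ha : 0 < a) (hs1 : -2 * a < s) (hs2 : s < 1 / 2) :
    (∫ x in Ioi (0 : ℝ), ∫ y in Ioi (0 : ℝ),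
        (x + y) ^ s * betaPrimeDensity a (1 / 2) x * betaPrimeDensity a (1 / 2) y)
      = (Real.Gamma (2 * a + s) * Real.Gamma (1 / 2 - s)
            / (Real.Gamma (2 * a) * Real.Gamma (1 / 2)))
        * (Real.Gamma (a + 1 / 2) / (Real.Gamma a * Real.Gamma (1 / 2)))
        * ∫ u in (0 : ℝ)..1, u ^ (a - 1) * (1 - u) ^ (-(1 / 2) : ℝ)
            * (1 + Real.sqrt u) ^ s := by
  have hα : 0 < 2 * a + s := by linarith
  have hβ : 0 < 1 / 2 - s := by linarith
  have hB := beta_pos hα hβ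
  have hB' := beta_pos (by positivity : 0 < 2 * a) (by norm_num : (0 : ℝ) < 1 / 2)
  have hBa := beta_pos ha (by norm_num : (0 : ℝ) < 1 / 2)
  have hΓ : 0 < Real.Gamma (2 * a + 1 / 2) := Real.Gamma_pos_of_pos (by positivity)
  have hU : ∫ u in (0 : ℝ)..1, u ^ (a - 1) * (1 - u) ^ (-(1 / 2) : ℝ) * (1 + √u) ^ s
      = (∫⁻ u in Ioo (0 : ℝ) 1, ENNReal.ofReal
        (u ^ (a - 1) * (1 - u) ^ (-(1 / 2) : ℝ) * (1 + √u) ^ s)).toReal := by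
    rw [intervalIntegral.integral_of_le zero_le_one, integral_Ioc_eq_integral_Ioo]
    refine integral_eq_lintegral_of_nonneg_ae ?_ ?_
    · filter_upwards [ae_restrict_mem measurableSet_Ioo] with u hu
      have h0 : 0 < u := hu.1
      have h1 : 0 < 1 - u := sub_pos.2 hu.2
      positivity
    · exact Measurable.aestronglyMeasurable (by fun_prop)
  have hK : Real.Gamma (2 * a + s) * Real.Gamma (1 / 2 - s)
      / (Real.Gamma (2 * a) * Real.Gamma (1 / 2))
      = beta (2 * a + s) (1 / 2 - s) / beta (2 * a) (1 / 2) := by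
    rw [beta, beta, show 2 * a + s + (1 / 2 - s) = 2 * a + 1 / 2 by ring,
      div_div_div_cancel_right₀ hΓ.ne']
  have hc : Real.Gamma (a + 1 / 2) / (Real.Gamma a * Real.Gamma (1 / 2)) = (beta a (1 / 2))⁻¹ := by
    rw [beta, inv_div]
  have hUR := beta_mul_lintegral_eq_beta_mul_lintegral ha hs1 hs2
  have hUW := lintegral_Ioo_rpow_mul_one_add_sqrt_rpow a s
  have hfin := lintegral_Ioo_rpow_mul_one_add_sqrt_rpow_ne_top ha s
  have hL : ∫⁻ x in Ioi (0 : ℝ), ∫⁻ y in Ioi (0 : ℝ), ENNReal.ofReal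
        ((x + y) ^ s * betaPrimeDensity a (1 / 2) x * betaPrimeDensity a (1 / 2) y)
      = ENNReal.ofReal (2 * (beta a (1 / 2))⁻¹) * ∫⁻ r in Ioi (0 : ℝ), ENNReal.ofReal
        (r ^ s * (r ^ (2 * a - 1) * (1 + r) ^ (-(1 / 2) : ℝ) * (2 + r) ^ (-(2 * a)))) := by
    rw [lintegral_lintegral_Ioi_eq_lintegral_lintegral_Ioo
        (F := fun x y => ENNReal.ofReal
          ((x + y) ^ s * betaPrimeDensity a (1 / 2) x * betaPrimeDensity a (1 / 2) y))
        (by unfold betaPrimeDensity Function.uncurry; fun_prop),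
      ← lintegral_const_mul' _ _ ENNReal.ofReal_ne_top]
    refine setLIntegral_congr_fun measurableSet_Ioi fun r hr => ?_
    have hr : 0 < r := hr
    have hA : 0 ≤ (beta a (1 / 2))⁻¹ ^ 2 * r ^ s := by positivity
    calc
      _ = ∫⁻ x in Ioo 0 r, ENNReal.ofReal ((beta a (1 / 2))⁻¹ ^ 2 * r ^ s) * ENNReal.ofReal
          ((x * (r - x)) ^ (a - 1) * ((1 + x) * (1 + (r - x))) ^ (-(a + 1 / 2))) := by
          refine setLIntegral_congr_fun measurableSet_Ioo fun x ⟨h0, h1⟩ => ?_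
          have h2 : 0 < r - x := sub_pos.2 h1
          simp only [betaPrimeDensity, hc]
          rw [← ENNReal.ofReal_mul hA, add_sub_cancel, Real.mul_rpow h0.le h2.le,
            Real.mul_rpow (by positivity) (by positivity)]
          congr 1
          ring
      _ = _ := by
          rw [lintegral_const_mul' _ _ ENNReal.ofReal_ne_top,
            lintegral_Ioo_mul_sub_rpow_mul_rpow ha hr, ← ENNReal.ofReal_mul (by positivity),
            ← ENNReal.ofReal_mul (by positivity), ← ENNReal.ofReal_mul (by positivity)]
          congr 1
          field_simp
  set R := ∫⁻ r in Ioi (0 : ℝ), ENNReal.ofReal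
    (r ^ s * (r ^ (2 * a - 1) * (1 + r) ^ (-(1 / 2) : ℝ) * (2 + r) ^ (-(2 * a))))
  set U := ∫⁻ u in Ioo (0 : ℝ) 1, ENNReal.ofReal
    (u ^ (a - 1) * (1 - u) ^ (-(1 / 2) : ℝ) * (1 + √u) ^ s)
  have hUR' : ENNReal.ofReal (beta (2 * a + s) (1 / 2 - s)) * U
      = 2 * (ENNReal.ofReal (beta (2 * a) (1 / 2)) * R) := by
    rw [← hUR, hUW]
    ring
  have hR : R ≠ ⊤ := by
    intro hR
    have h := ENNReal.mul_ne_top (ENNReal.ofReal_ne_top (r := beta (2 * a + s) (1 / 2 - s))) hfin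
    rw [hUR', hR, ENNReal.mul_top (ENNReal.ofReal_pos.2 hB').ne'] at h
    exact h (ENNReal.mul_top two_ne_zero)
  have hreal : beta (2 * a + s) (1 / 2 - s) * U.toReal
      = 2 * (beta (2 * a) (1 / 2) * R.toReal) := by
    have h := congrArg ENNReal.toReal hUR'
    simpa only [ENNReal.toReal_mul, ENNReal.toReal_ofReal hB.le, ENNReal.toReal_ofReal hB'.le,
      ENNReal.toReal_ofNat] using h
  rw [hU, hK, hc, setIntegral_setIntegral_eq_toReal measurableSet_Ioi measurableSet_Ioi
    (by unfold betaPrimeDensity Function.uncurry; fun_prop) ?_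
    (hL ▸ ENNReal.mul_ne_top ENNReal.ofReal_ne_top hR), hL, ENNReal.toReal_mul,
    ENNReal.toReal_ofReal (by positivity)]
  · rw [div_mul_eq_mul_div, div_mul_eq_mul_div,
      mul_right_comm (beta (2 * a + s) (1 / 2 - s)), hreal]
    field_simp
  · intro x hx y hy
    have hx : 0 < x := hx
    have hy : 0 < y := hy
    simp only [betaPrimeDensity, hc]
    positivity
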